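/- Let S be a multiplicative set of positive integers satisfying Condition B with density δ > 0 and exponent ρ > 0, and suppose in addition that S is the free multiplicative semigroup generated by a set Q = {q_1, q_2, …} of prime powers with at most one power of each prime; that is, S consists exactly of 1 and all finite products of the q_i's (each n ∈ S having a unique such representation). Then γ_S = lim_{x→∞} ( δ·log x − Σ_{q_i ≤ x} (log q_i)/(q_i − 1) ), where γ_S is the Euler–Kronecker constant of S. -/

import Mathlib

open Filter Real
open scoped Classical

/-- A set of positive integers is *multiplicative* if `1 ∈ S` and for all coprime
positive integers `m, n` one has `m * n ∈ S ↔ m ∈ S ∧ n ∈ S`. -/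
def IsMultiplicativeSet (S : Set ℕ) : Prop :=
  1 ∈ S ∧ ∀ m n : ℕ, 0 < m → 0 < n → Nat.Coprime m n → (m * n ∈ S ↔ m ∈ S ∧ n ∈ S)

/-- `S(x)`: the number of `n ≤ x` with `n ∈ S`. -/
noncomputable def setCount (S : Set ℕ) (x : ℝ) : ℕ :=
  {n : ℕ | 0 < n ∧ (n : ℝ) ≤ x ∧ n ∈ S}.ncard

/-- `π_S(x)`: the number of primes `p ≤ x` with `p ∈ S`. -/
noncomputable def primeCount (S : Set ℕ) (x : ℝ) : ℕ :=
  {p : ℕ | p.Prime ∧ (p : ℝ) ≤ x ∧ p ∈ S}.ncard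

/-- The characteristic function of `S`. -/
noncomputable def chiS (S : Set ℕ) (n : ℕ) : ℝ := if n ∈ S then 1 else 0

/-- The logarithmic integral `Li(x) = ∫₂ˣ dt / log t`. -/
noncomputable def Li (x : ℝ) : ℝ := ∫ t in (2:ℝ)..x, 1 / Real.log t

/-- Condition B with density `δ` and exponent `ρ`:
`π_S(x) = δ Li(x) + O(x / (log x)^{2+ρ})`. -/
def ConditionB (S : Set ℕ) (δ ρ : ℝ) : Prop :=
  ∃ C : ℝ, ∀ x : ℝ, 2 ≤ x →
    |(primeCount S x : ℝ) - δ * Li x| ≤ C * x / Real.log x ^ (2 + ρ)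

/-- The Dirichlet series `L_S(s) = ∑_{n ∈ S} n^{-s}` of `S` (as a function of a real
variable `s`). -/
noncomputable def LSeries' (S : Set ℕ) (s : ℝ) : ℝ :=
  ∑' n : ℕ, if n ∈ S then (n : ℝ) ^ (-s) else 0

/-- `γS` is the Euler–Kronecker constant of `S` (with density `δ`), i.e.
`L_S'(s)/L_S(s) + δ/(s-1) → γS` as `s → 1⁺`. -/
def IsEulerKronecker (S : Set ℕ) (δ γS : ℝ) : Prop :=
  Tendsto (fun s : ℝ => deriv (LSeries' S) s / LSeries' S s + δ / (s - 1))
    (nhdsWithin 1 (Set.Ioi 1)) (nhds γS)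

/-- The partial Euler-type product
`∏_{p < P, p prime} (1 + χ_S(p)/p + χ_S(p²)/p² + …) (1 - 1/p)^δ`. -/
noncomputable def wirsingProd (S : Set ℕ) (δ : ℝ) (P : ℕ) : ℝ :=
  ∏ p ∈ Finset.filter Nat.Prime (Finset.range P),
    (∑' e : ℕ, chiS S (p ^ e) / (p : ℝ) ^ e) * (1 - 1 / (p : ℝ)) ^ δ

/-- Summation by parts: weighted increments of an antitone sequence, where the weights are bounded
by `M` throughout and by `η` from index `K` on. -/
lemma abs_sum_mul_sub_succ_le {B v : ℕ → ℝ} {M η : ℝ} {K : ℕ} (hv : Antitone v)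
    (hM : ∀ n, |B n| ≤ M) (hη : ∀ n, K ≤ n → |B n| ≤ η) {N : ℕ} (hN : K ≤ N) :
    |∑ k ∈ Finset.range N, B (k + 1) * (v k - v (k + 1))| ≤
      M * (v 0 - v K) + η * (v K - v N) := by
  have key : ∀ (b : ℝ) (k : ℕ), |B (k + 1)| ≤ b →
      |B (k + 1) * (v k - v (k + 1))| ≤ b * (v k - v (k + 1)) := by
    intro b k hb
    have h0 : 0 ≤ v k - v (k + 1) := sub_nonneg.2 (hv (Nat.le_succ k))
    rw [abs_mul, abs_of_nonneg h0]
    exact mul_le_mul_of_nonneg_right hb h0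
  induction N, hN using Nat.le_induction with
  | base =>
    calc _ ≤ ∑ k ∈ Finset.range K, M * (v k - v (k + 1)) :=
          (Finset.abs_sum_le_sum_abs _ _).trans
            (Finset.sum_le_sum fun k _ => key M k (hM _))
      _ = _ := by rw [← Finset.mul_sum, Finset.sum_range_sub']; ring
  | succ n hn ih =>
    rw [Finset.sum_range_succ]
    refine (abs_add_le _ _).trans ?_
    linarith [key η n (hη _ (by omega))]

/-- Abel's theorem for Dirichlet series at the point `0`: if `∑ c n` converges to `ℓ`, then
`∑ c n * n ^ (-ε) → ℓ` as `ε → 0⁺`. -/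
lemma tendsto_tsum_mul_rpow_neg {c : ℕ → ℝ} {ℓ : ℝ} (hc0 : c 0 = 0)
    (hc : Tendsto (fun N => ∑ n ∈ Finset.range N, c n) atTop (nhds ℓ))
    (hs : ∀ ε : ℝ, 0 < ε → Summable fun n : ℕ => c n * (n : ℝ) ^ (-ε)) :
    Tendsto (fun ε : ℝ => ∑' n : ℕ, c n * (n : ℝ) ^ (-ε)) (nhdsWithin 0 (Set.Ioi 0))
      (nhds ℓ) := by
  set B : ℕ → ℝ := fun N => ∑ n ∈ Finset.range (N + 1), c n - ℓ with hBdef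
  have hB : Tendsto B atTop (nhds 0) := by
    simpa using ((tendsto_add_atTop_iff_nat 1).2 hc).sub_const ℓ
  obtain ⟨M, hM⟩ : ∃ M, ∀ n, |B n| ≤ M := by
    obtain ⟨M, hM⟩ := hB.abs.bddAbove_range
    exact ⟨M, fun n => hM ⟨n, rfl⟩⟩
  have hM0 : 0 ≤ M := (abs_nonneg _).trans (hM 0)
  have parts : ∀ (v : ℕ → ℝ) (N : ℕ), ∑ k ∈ Finset.range N, c (k + 1) * v k - ℓ * v 0 =
      B N * v N + ∑ k ∈ Finset.range N, B (k + 1) * (v k - v (k + 1)) := by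
    intro v N
    induction N with
    | zero => simp [hBdef, hc0]
    | succ n ih =>
      have : B (n + 1) = B n + c (n + 1) := by
        simp only [hBdef]; rw [Finset.sum_range_succ]; ring
      rw [Finset.sum_range_succ, Finset.sum_range_succ, add_sub_right_comm, ih, this]
      ring
  rw [Metric.tendsto_nhds]
  intro η hη
  obtain ⟨K, hK⟩ : ∃ K, ∀ n, K ≤ n → |B n| ≤ η / 4 := by
    have := (Metric.tendsto_atTop.1 hB) (η / 4) (by positivity)
    obtain ⟨K, hK⟩ := this
    exact ⟨K, fun n hn => by simpa using (hK n hn).le⟩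
  have hlim : Tendsto (fun ε : ℝ => M * (1 - ((K + 1 : ℕ) : ℝ) ^ (-ε)))
      (nhdsWithin 0 (Set.Ioi 0)) (nhds 0) := by
    have h1 : ContinuousAt (fun ε : ℝ => M * (1 - ((K + 1 : ℕ) : ℝ) ^ (-ε))) 0 := by
      have : ((K + 1 : ℕ) : ℝ) ≠ 0 := by positivity
      fun_prop (disch := simp_all)
    have h2 := h1.tendsto
    simp only [neg_zero, Real.rpow_zero, sub_self, mul_zero] at h2
    exact h2.mono_left nhdsWithin_le_nhds
  filter_upwards [hlim.eventually (gt_mem_nhds (show (0 : ℝ) < η / 4 by positivity)),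
    self_mem_nhdsWithin] with ε hε hε0
  have hε0 : 0 < ε := hε0
  set v : ℕ → ℝ := fun n => ((n + 1 : ℕ) : ℝ) ^ (-ε) with hvdef
  have hv : Antitone v := fun a b hab =>
    Real.rpow_le_rpow_of_nonpos (by positivity) (by gcongr) (by linarith)
  have hv0 : v 0 = 1 := by simp [hvdef]
  have hvpos : ∀ n, 0 ≤ v n := fun n => by positivity
  have hle1 : ∀ n, v n ≤ 1 := fun n => hv0 ▸ hv (Nat.zero_le n)
  have hsum : Tendsto (fun N => ∑ k ∈ Finset.range N, c (k + 1) * v k) atTop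
      (nhds (∑' n : ℕ, c n * (n : ℝ) ^ (-ε))) := by
    have h := (hs ε hε0).hasSum
    rw [← hasSum_nat_add_iff' 1] at h
    simpa [hc0, hvdef] using h.tendsto_sum_nat
  have hbd : ∀ᶠ N in atTop, |∑ k ∈ Finset.range N, c (k + 1) * v k - ℓ| ≤ 3 * η / 4 := by
    filter_upwards [eventually_ge_atTop K] with N hN
    have h1 := parts v N
    rw [hv0, mul_one] at h1
    rw [h1]
    have h2 := abs_sum_mul_sub_succ_le hv hM hK hN
    have h3 : |B N * v N| ≤ η / 4 := by
      rw [abs_mul, abs_of_nonneg (hvpos N)]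
      nlinarith [hK N hN, hle1 N, hvpos N, abs_nonneg (B N)]
    have h4 : η / 4 * (v K - v N) ≤ η / 4 := by nlinarith [hle1 K, hvpos N]
    have h5 : M * (v 0 - v K) < η / 4 := by rw [hv0]; exact hε
    linarith [abs_add_le (B N * v N) (∑ k ∈ Finset.range N, B (k + 1) * (v k - v (k + 1)))]
  have := le_of_tendsto ((hsum.sub_const ℓ).abs) hbd
  rw [Real.dist_eq]
  linarith

/-- `∑ n ^ (-s) - 1 / (s - 1) → γ` as `s → 1⁺` along the reals. -/
lemma tendsto_tsum_rpow_neg_sub_one_div :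
    Tendsto (fun s : ℝ => ∑' n : ℕ, (n : ℝ) ^ (-s) - 1 / (s - 1)) (nhdsWithin 1 (Set.Ioi 1))
      (nhds Real.eulerMascheroniConstant) := by
  have h := ZetaAsymptotics.tendsto_riemannZeta_sub_one_div_nhds_right
  have h2 := (Complex.continuous_re.tendsto _).comp h
  simp only [Complex.ofReal_re] at h2
  refine h2.congr' ?_
  filter_upwards [self_mem_nhdsWithin] with s hs
  have hs : 1 < s := hs
  have : riemannZeta s = ((∑' n : ℕ, (n : ℝ) ^ (-s) : ℝ) : ℂ) := by
    rw [zeta_eq_tsum_one_div_nat_cpow (by simpa using hs), Complex.ofReal_tsum]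
    refine tsum_congr fun n => ?_
    rw [Complex.ofReal_cpow (Nat.cast_nonneg n), one_div, ← Complex.cpow_neg]
    simp
  simp only [Function.comp, this]
  rw [← Complex.ofReal_one, ← Complex.ofReal_sub, ← Complex.ofReal_div, ← Complex.ofReal_sub,
    Complex.ofReal_re]

lemma summable_log_mul_rpow_neg {s : ℝ} (hs : 1 < s) :
    Summable fun n : ℕ => Real.log n * (n : ℝ) ^ (-s) := by
  have h : Summable fun n : ℕ => (n : ℝ) ^ (-((s + 1) / 2)) / ((s - 1) / 2) :=
    (Real.summable_nat_rpow.2 (by linarith)).div_const _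
  refine h.of_nonneg_of_le (fun n => mul_nonneg (Real.log_natCast_nonneg n) (by positivity))
    fun n => ?_
  rcases Nat.eq_zero_or_pos n with rfl | hn
  · simp only [Nat.cast_zero, Real.log_zero, zero_mul]
    have : 0 < s - 1 := by linarith
    positivity
  · have hn' : (0 : ℝ) < n := by exact_mod_cast hn
    have h1 := Real.log_le_rpow_div hn'.le (show 0 < (s - 1) / 2 by linarith)
    calc Real.log n * (n : ℝ) ^ (-s) ≤ (n : ℝ) ^ ((s - 1) / 2) / ((s - 1) / 2) * (n : ℝ) ^ (-s) := by
          gcongr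
      _ = _ := by
          rw [div_mul_eq_mul_div, ← Real.rpow_add hn']
          congr 2
          ring

/-- A power of the prime `p` lies in the semigroup iff it is a power of the generator divisible
by `p`. -/
lemma prime_pow_mem_semigroup_iff {S Q : Set ℕ} (hQpp : ∀ q ∈ Q, IsPrimePow q)
    (hQdist : ∀ q₁ ∈ Q, ∀ q₂ ∈ Q, ∀ p : ℕ, p.Prime → p ∣ q₁ → p ∣ q₂ → q₁ = q₂)
    (hgen : ∀ n : ℕ, n ∈ S ↔ ∃ f : ℕ →₀ ℕ,
      (∀ q ∈ f.support, q ∈ Q) ∧ n = f.prod fun q e => q ^ e)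
    {p e : ℕ} (hp : p.Prime) :
    p ^ e ∈ S ↔ e = 0 ∨ ∃ q ∈ Q, p ∣ q ∧ ∃ j, p ^ e = q ^ j := by
  rw [hgen]
  constructor
  · rintro ⟨f, hf, he⟩
    have hdvd : ∀ q ∈ f.support, p ∣ q := by
      intro q hq
      have h1 : q ∣ p ^ e := by
        rw [he]
        exact (dvd_pow_self q (Finsupp.mem_support_iff.1 hq)).trans
          (Finset.dvd_prod_of_mem (fun q => q ^ f q) hq)
      obtain ⟨i, -, rfl⟩ := (Nat.dvd_prime_pow hp).1 h1
      refine dvd_pow_self p ?_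
      rintro rfl
      exact (hQpp _ (hf _ hq)).ne_one (pow_zero p)
    rcases f.support.eq_empty_or_nonempty with h | ⟨q, hq⟩
    · left
      rw [Finsupp.support_eq_empty.1 h, Finsupp.prod_zero_index] at he
      exact (Nat.pow_eq_one.1 he).resolve_left hp.one_lt.ne'
    · right
      refine ⟨q, hf q hq, hdvd q hq, f q, ?_⟩
      have hsup : f.support = {q} :=
        Finset.eq_singleton_iff_unique_mem.2 ⟨hq, fun r hr =>
          hQdist r (hf r hr) q (hf q hq) p hp (hdvd r hr) (hdvd q hq)⟩
      rw [he, Finsupp.prod, hsup, Finset.prod_singleton]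
  · rintro (rfl | ⟨q, hq, -, j, hj⟩)
    · exact ⟨0, by simp, by simp⟩
    · refine ⟨Finsupp.single q j, fun r hr => ?_, ?_⟩
      · rw [Finset.mem_singleton.1 (Finsupp.support_single_subset hr)]
        exact hq
      · rw [hj, Finsupp.prod_single_index (pow_zero q)]

/-- The Euler product of the Dirichlet series of a multiplicative semigroup over its
generators. -/
lemma hasProd_LSeries' {S Q : Set ℕ} (hS : IsMultiplicativeSet S)
    (hQpp : ∀ q ∈ Q, IsPrimePow q)
    (hQdist : ∀ q₁ ∈ Q, ∀ q₂ ∈ Q, ∀ p : ℕ, p.Prime → p ∣ q₁ → p ∣ q₂ → q₁ = q₂)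
    (hgen : ∀ n : ℕ, n ∈ S ↔ ∃ f : ℕ →₀ ℕ,
      (∀ q ∈ f.support, q ∈ Q) ∧ n = f.prod fun q e => q ^ e)
    {s : ℝ} (hs : 1 < s) :
    HasProd (fun q : Q => (1 - ((q : ℕ) : ℝ) ^ (-s))⁻¹) (LSeries' S s) := by
  set f : ℕ → ℝ := fun n => if n ∈ S then (n : ℝ) ^ (-s) else 0 with hf
  have hf0 : f 0 = 0 := by simp [hf, Real.zero_rpow (show -s ≠ 0 by linarith)]
  have hf1 : f 1 = 1 := by simp [hf, hS.1]
  have hmul : ∀ {m n : ℕ}, m.Coprime n → f (m * n) = f m * f n := by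
    intro m n hmn
    rcases Nat.eq_zero_or_pos m with rfl | hm
    · simp [hf0]
    rcases Nat.eq_zero_or_pos n with rfl | hn
    · simp [hf0]
    have := hS.2 m n hm hn hmn
    by_cases h1 : m ∈ S <;> by_cases h2 : n ∈ S <;>
      simp [hf, this, h1, h2, Real.mul_rpow]
  have hsum : Summable fun n => ‖f n‖ := by
    refine (Real.summable_nat_rpow.2 (show -s < -1 by linarith)).of_nonneg_of_le
      (fun n => norm_nonneg _) fun n => ?_
    simp only [hf]
    split_ifs
    · rw [Real.norm_of_nonneg (by positivity)]
    · simpa using Real.rpow_nonneg (Nat.cast_nonneg n) _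
  have hprod := EulerProduct.eulerProduct_hasProd hf1 hmul hsum hf0
  have hmem := fun {p e : ℕ} (hp : p.Prime) =>
    prime_pow_mem_semigroup_iff (e := e) hQpp hQdist hgen hp
  let i : Q → Nat.Primes := fun q => ⟨(q : ℕ).minFac, Nat.minFac_prime (hQpp q q.2).ne_one⟩
  have hi : Function.Injective i := by
    intro q r hqr
    have h : (q : ℕ).minFac = (r : ℕ).minFac := congrArg Subtype.val hqr
    exact Subtype.ext (hQdist q q.2 r r.2 _ (i q).2 (Nat.minFac_dvd _) ((dvd_of_eq h).trans (Nat.minFac_dvd _)))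
  have hout : ∀ p ∉ Set.range i, ∑' e : ℕ, f ((p : ℕ) ^ e) = 1 := by
    intro p hp
    rw [tsum_eq_single 0]
    · simp [hf1]
    · intro e he
      simp only [hf]
      rw [if_neg]
      rw [hmem p.2]
      rintro (h | ⟨q, hq, hpq, -⟩)
      · exact he h
      · refine hp ⟨⟨q, hq⟩, Subtype.ext ?_⟩
        obtain ⟨r, k, hr, hk, rfl⟩ := (isPrimePow_nat_iff q).1 (hQpp q hq)
        rw [(Nat.prime_dvd_prime_iff_eq p.2 hr).1 (p.2.dvd_of_dvd_pow hpq)]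
        exact hr.pow_minFac hk.ne'
  have := (hi.hasProd_iff hout).2 hprod
  refine this.congr_fun ?_
  intro q
  obtain ⟨q, hq⟩ := q
  obtain ⟨p, k, hp, hk, hpk⟩ := (isPrimePow_nat_iff q).1 (hQpp q hq)
  have hiq : ((i ⟨q, hq⟩ : Nat.Primes) : ℕ) = p := by
    simp only [i, ← hpk]
    exact hp.pow_minFac hk.ne'
  have hq1 : (1 : ℝ) < q := by exact_mod_cast (hQpp q hq).one_lt
  simp only [Function.comp, hiq]
  have hinj : Function.Injective fun j : ℕ => k * j := fun a b h => Nat.eq_of_mul_eq_mul_left hk h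
  rw [← hinj.tsum_eq, ← tsum_geometric_of_lt_one (by positivity)
    (Real.rpow_lt_one_of_one_lt_of_neg hq1 (by linarith))]
  · refine tsum_congr fun j => ?_
    simp only [hf]
    rw [if_pos, pow_mul, hpk, Nat.cast_pow, ← Real.rpow_natCast, ← Real.rpow_natCast,
      ← Real.rpow_mul (by positivity), ← Real.rpow_mul (by positivity), mul_comm]
    rw [hmem hp]
    exact Or.inr ⟨q, hq, hpk ▸ dvd_pow_self p hk.ne', j, by rw [pow_mul, hpk]⟩
  · intro e he
    have he' : p ^ e ∈ S := by
      by_contra h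
      exact he (by simp [hf, h])
    rcases (hmem hp).1 he' with rfl | ⟨r, hr, hpr, j, hj⟩
    · exact ⟨0, by simp⟩
    · refine ⟨j, ?_⟩
      have : r = q := hQdist r hr q hq p hp hpr (hpk ▸ dvd_pow_self p hk.ne')
      rw [this, ← hpk, ← pow_mul] at hj
      exact (Nat.pow_right_injective hp.two_le hj).symm

/-- The logarithmic derivative of a product `∏ (1 - q ^ (-s))⁻¹`. -/
lemma deriv_div_self_of_hasProd {Q : Set ℕ} (hQ : ∀ q ∈ Q, 1 < q) {L : ℝ → ℝ}
    (hL : ∀ s : ℝ, 1 < s → HasProd (fun q : Q => (1 - ((q : ℕ) : ℝ) ^ (-s))⁻¹) (L s))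
    {s : ℝ} (hs : 1 < s) :
    deriv L s / L s =
      -∑' q : Q, Real.log (q : ℕ) / (((q : ℕ) : ℝ) ^ s - 1) := by
  have hQ1 : ∀ q : Q, (2 : ℝ) ≤ ((q : ℕ) : ℝ) := fun q => by exact_mod_cast hQ q q.2
  have hlt : ∀ (q : Q) (y : ℝ), 1 < y → ((q : ℕ) : ℝ) ^ (-y) ≤ 1 / 2 := by
    intro q y hy
    calc ((q : ℕ) : ℝ) ^ (-y) ≤ (2 : ℝ) ^ (-y) :=
          Real.rpow_le_rpow_of_nonpos (by norm_num) (hQ1 q) (by linarith)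
      _ ≤ (2 : ℝ) ^ (-1 : ℝ) := Real.rpow_le_rpow_of_exponent_le (by norm_num) (by linarith)
      _ = 1 / 2 := by rw [Real.rpow_neg_one]; norm_num
  have hsm : ∀ y : ℝ, 1 < y →
      Summable fun q : Q => Real.log (1 - ((q : ℕ) : ℝ) ^ (-y))⁻¹ := by
    intro y hy
    have h1 : Summable fun q : Q => -((q : ℕ) : ℝ) ^ (-y) :=
      ((Real.summable_nat_rpow.2 (show -y < -1 by linarith)).comp_injective
        Subtype.val_injective).neg
    simpa [Real.log_inv, sub_eq_add_neg] using (Real.summable_log_one_add_of_summable h1).neg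
  have hexp : ∀ y : ℝ, 1 < y →
      L y = Real.exp (∑' q : Q, Real.log (1 - ((q : ℕ) : ℝ) ^ (-y))⁻¹) := by
    intro y hy
    refine (hL y hy).unique (Real.hasProd_of_hasSum_log (fun q => ?_) (hsm y hy).hasSum)
    have := hlt q y hy
    exact inv_pos.2 (by linarith)
  obtain ⟨t, ht1, hts⟩ := exists_between hs
  have hder : HasDerivAt (fun y => ∑' q : Q, Real.log (1 - ((q : ℕ) : ℝ) ^ (-y))⁻¹)
      (∑' q : Q, -(Real.log (q : ℕ) / (((q : ℕ) : ℝ) ^ s - 1))) s := by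
    have hu : Summable fun q : Q => 2 * (Real.log (q : ℕ) * ((q : ℕ) : ℝ) ^ (-t)) :=
      ((summable_log_mul_rpow_neg ht1).comp_injective Subtype.val_injective).mul_left 2
    refine hasDerivAt_tsum_of_isPreconnected
      (g := fun (q : Q) (y : ℝ) => Real.log (1 - ((q : ℕ) : ℝ) ^ (-y))⁻¹)
      (g' := fun (q : Q) (y : ℝ) => -(Real.log (q : ℕ) / (((q : ℕ) : ℝ) ^ y - 1)))
      (t := Set.Ioi t) hu isOpen_Ioi isPreconnected_Ioi ?_ ?_ hts (hsm s hs) hts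
    · intro q y hy
      have hy1 : 1 < y := ht1.trans hy
      have hq0 : (0 : ℝ) < ((q : ℕ) : ℝ) := by linarith [hQ1 q]
      have h2 := hlt q y hy1
      have hd : HasDerivAt (fun y : ℝ => ((q : ℕ) : ℝ) ^ (-y))
          (Real.log (q : ℕ) * (-1) * ((q : ℕ) : ℝ) ^ (-y)) y :=
        (hasDerivAt_neg y).const_rpow hq0
      have hd2 := ((hd.const_sub 1).log (by linarith)).neg
      simp only [Real.log_inv]
      refine hd2.congr_deriv ?_
      have h3 : ((q : ℕ) : ℝ) ^ y - 1 ≠ 0 :=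
        (sub_pos.2 (Real.one_lt_rpow (by linarith [hQ1 q]) (by linarith))).ne'
      rw [Real.rpow_neg hq0.le] at h2 ⊢
      have h4 : ((q : ℕ) : ℝ) ^ y ≠ 0 := (Real.rpow_pos_of_pos hq0 y).ne'
      field_simp
    · intro q y hy
      have hy1 : 1 < y := ht1.trans hy
      have hq0 : (0 : ℝ) < ((q : ℕ) : ℝ) := by linarith [hQ1 q]
      have h2 := hlt q t ht1
      have hA : (2 : ℝ) ≤ ((q : ℕ) : ℝ) ^ t := by
        rw [Real.rpow_neg hq0.le, inv_eq_one_div,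
          div_le_div_iff₀ (Real.rpow_pos_of_pos hq0 t) (by norm_num)] at h2
        linarith
      have hAB : ((q : ℕ) : ℝ) ^ t ≤ ((q : ℕ) : ℝ) ^ y :=
        Real.rpow_le_rpow_of_exponent_le (by linarith [hQ1 q]) (le_of_lt hy)
      have hlog := Real.log_natCast_nonneg (q : ℕ)
      rw [norm_neg, Real.norm_of_nonneg (div_nonneg hlog (by linarith)), Real.rpow_neg hq0.le,
        div_eq_mul_inv, ← mul_assoc, mul_comm 2, mul_assoc]
      refine mul_le_mul_of_nonneg_left ?_ hlog
      rw [← div_eq_mul_inv, inv_eq_one_div, div_le_div_iff₀ (by linarith) (by linarith)]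
      linarith
  have hLd : HasDerivAt L _ s := hder.exp.congr_of_eventuallyEq
    (Filter.eventuallyEq_of_mem (Ioi_mem_nhds hs) fun y hy => hexp y hy)
  rw [hLd.deriv, ← hexp s hs, mul_div_cancel_left₀, tsum_neg]
  rw [hexp s hs]
  exact (Real.exp_pos _).ne'

lemma hasDerivAt_Li {t : ℝ} (ht : 2 ≤ t) : HasDerivAt Li (1 / Real.log t) t := by
  have hcont : ContinuousOn (fun t : ℝ => 1 / Real.log t) (Set.Ioi 1) := by
    intro u hu
    have hu : 1 < u := hu
    have h1 : u ≠ 0 := by linarith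
    have h2 : Real.log u ≠ 0 := (Real.log_pos hu).ne'
    exact (continuousAt_const.div (Real.continuousAt_log h1) h2).continuousWithinAt
  have hmem : t ∈ Set.Ioi (1 : ℝ) := by simp only [Set.mem_Ioi]; linarith
  refine intervalIntegral.integral_hasDerivAt_right ?_ ?_ ?_
  · refine (hcont.mono fun u hu => ?_).intervalIntegrable
    rw [Set.uIcc_of_le ht] at hu
    exact lt_of_lt_of_le (by norm_num) hu.1
  · exact hcont.stronglyMeasurableAtFilter isOpen_Ioi t hmem
  · exact hcont.continuousAt (isOpen_Ioi.mem_nhds hmem)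

lemma sum_primes_eq_primeCount (S : Set ℕ) {t : ℝ} (ht : 0 ≤ t) :
    ∑ k ∈ Finset.Icc 0 ⌊t⌋₊, (if k.Prime ∧ k ∈ S then (1 : ℝ) else 0) = primeCount S t := by
  rw [Finset.sum_boole, primeCount, ← Set.ncard_coe_finset]
  congr 2
  ext p
  simp only [Finset.coe_filter, Finset.mem_Icc, zero_le, true_and, Set.mem_ofPred_eq,
    Nat.le_floor_iff ht]
  tauto

lemma monotone_primeCount (S : Set ℕ) : Monotone fun t : ℝ => (primeCount S t : ℝ) := by
  intro a b hab
  simp only [Nat.cast_le]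
  refine Set.ncard_le_ncard (fun p hp => ⟨hp.1, hp.2.1.trans hab, hp.2.2⟩) ?_
  refine (Set.finite_Iic ⌊b⌋₊).subset fun p hp => ?_
  exact Nat.le_floor hp.2.1

lemma integrableOn_log_rpow_div {ρ : ℝ} (hρ : 0 < ρ) :
    MeasureTheory.IntegrableOn (fun t : ℝ => Real.log t ^ (-ρ - 1) / t) (Set.Ioi 2) := by
  have hd : ∀ t : ℝ, 2 ≤ t →
      HasDerivAt (fun t : ℝ => -(Real.log t ^ (-ρ) / ρ)) (Real.log t ^ (-ρ - 1) / t) t := by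
    intro t ht
    have hl : 0 < Real.log t := Real.log_pos (by linarith)
    have h := (((Real.hasDerivAt_log (show t ≠ 0 by linarith)).rpow_const
      (p := -ρ) (Or.inl hl.ne')).div_const ρ).neg
    refine h.congr_deriv ?_
    field_simp
  refine MeasureTheory.integrableOn_Ioi_deriv_of_nonneg (l := 0)
    (hd 2 le_rfl).continuousAt.continuousWithinAt (fun t ht => hd t (le_of_lt ht)) ?_ ?_
  · intro t ht
    have ht : 2 < t := ht
    have hl : 0 < Real.log t := Real.log_pos (by linarith)
    positivity
  · simpa using (((tendsto_rpow_neg_atTop hρ).comp Real.tendsto_log_atTop).div_const ρ).neg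

/-- Mertens-type estimate: under Condition B the sums `∑ log p / p` over the primes of `S` are
`δ log N` up to a convergent error. -/
lemma exists_tendsto_sum_log_div_sub {S : Set ℕ} {δ ρ : ℝ} (hρ : 0 < ρ)
    (hB : ConditionB S δ ρ) :
    ∃ ℓ : ℝ, Tendsto (fun N : ℕ => ∑ n ∈ Finset.Ioc 2 N,
      Real.log n / n * (if n.Prime ∧ n ∈ S then 1 else 0) - δ * Real.log N) atTop (nhds ℓ) := by
  obtain ⟨C, hC⟩ := hB
  set E : ℝ → ℝ := fun t => (primeCount S t : ℝ) - δ * Li t with hE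
  set f' : ℝ → ℝ := fun t => (1 - Real.log t) / t ^ 2 with hf'
  have hfd : ∀ t : ℝ, 2 ≤ t → HasDerivAt (fun t : ℝ => Real.log t / t) (f' t) t := by
    intro t ht
    have ht0 : t ≠ 0 := by linarith
    refine ((Real.hasDerivAt_log ht0).div (hasDerivAt_id t) ht0).congr_deriv ?_
    simp only [hf', id]
    field_simp
  have hf'c : ContinuousOn f' (Set.Ici 2) := by
    intro t ht
    have ht0 : t ≠ 0 := by
      have : 2 ≤ t := ht
      linarith
    refine ContinuousAt.continuousWithinAt ?_
    simp only [hf']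
    fun_prop (disch := simpa using ht0)
  have hLic : ContinuousOn Li (Set.Ici 2) := fun t ht =>
    (hasDerivAt_Li ht).continuousAt.continuousWithinAt
  have hint : MeasureTheory.IntegrableOn (fun t => f' t * E t) (Set.Ioi 2) := by
    refine MeasureTheory.Integrable.mono' ((integrableOn_log_rpow_div hρ).const_mul (3 * C)) ?_ ?_
    · have h1 := (hf'c.mono Set.Ioi_subset_Ici_self).aestronglyMeasurable
        (μ := MeasureTheory.volume) measurableSet_Ioi
      have h2 := (hLic.mono Set.Ioi_subset_Ici_self).aestronglyMeasurable
        (μ := MeasureTheory.volume) measurableSet_Ioi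
      exact h1.mul ((monotone_primeCount S).measurable.aestronglyMeasurable.sub (h2.const_mul δ))
    · refine (MeasureTheory.ae_restrict_iff' measurableSet_Ioi).2 (Eventually.of_forall ?_)
      intro t ht
      have ht : 2 < t := ht
      have hl2 : Real.log 2 < Real.log t := Real.log_lt_log (by norm_num) ht
      have hl : 1 / 2 < Real.log t := by linarith [Real.log_two_gt_d9]
      have h1 : |1 - Real.log t| ≤ 3 * Real.log t := abs_le.2 ⟨by linarith, by linarith⟩
      have h2 := hC t ht.le
      have h3 : Real.log t ^ (2 + ρ) = Real.log t / Real.log t ^ (-ρ - 1) := by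
        rw [eq_div_iff (Real.rpow_pos_of_pos (by linarith) _).ne',
          ← Real.rpow_add (by linarith)]
        ring_nf
        exact Real.rpow_one _
      calc ‖f' t * E t‖ = |1 - Real.log t| / t ^ 2 * |E t| := by
            rw [Real.norm_eq_abs, abs_mul, hf', abs_div, abs_of_nonneg (sq_nonneg t)]
        _ ≤ 3 * Real.log t / t ^ 2 * (C * t / Real.log t ^ (2 + ρ)) := by
            gcongr
        _ = _ := by
            have := (Real.rpow_pos_of_pos (show 0 < Real.log t by linarith) (-ρ - 1)).ne'
            rw [h3]
            field_simp
  have hbdry : Tendsto (fun N : ℕ => Real.log N / N * E N) atTop (nhds 0) := by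
    have h0 : Tendsto (fun N : ℕ => C * Real.log N ^ (-(1 + ρ))) atTop (nhds 0) := by
      simpa using ((tendsto_rpow_neg_atTop (show 0 < 1 + ρ by linarith)).comp
        (Real.tendsto_log_atTop.comp tendsto_natCast_atTop_atTop)).const_mul C
    refine squeeze_zero_norm' ?_ h0
    filter_upwards [eventually_ge_atTop 2] with N hN
    have hN' : (2 : ℝ) ≤ N := by exact_mod_cast hN
    have hl : 0 < Real.log N := Real.log_pos (by linarith)
    have h3 : Real.log N ^ (2 + ρ) = Real.log N / Real.log N ^ (-(1 + ρ)) := by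
      rw [eq_div_iff (Real.rpow_pos_of_pos hl _).ne', ← Real.rpow_add hl]
      ring_nf
      exact Real.rpow_one _
    rw [norm_mul, Real.norm_of_nonneg (by positivity), Real.norm_eq_abs]
    calc _ ≤ Real.log N / N * (C * N / Real.log N ^ (2 + ρ)) := by
          gcongr
          exact hC N hN'
      _ = _ := by
          have := (Real.rpow_pos_of_pos hl (-(1 + ρ))).ne'
          rw [h3]
          field_simp
  have hI := MeasureTheory.intervalIntegral_tendsto_integral_Ioi 2 hint
    (tendsto_natCast_atTop_atTop (R := ℝ))
  refine ⟨_, Tendsto.congr' ?_ ((hbdry.sub hI).sub_const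
    (Real.log 2 / 2 * primeCount S 2 + δ * Real.log 2))⟩
  filter_upwards [eventually_ge_atTop 2] with N hN
  have hN' : (2 : ℝ) ≤ N := by exact_mod_cast hN
  have hsub : Set.Icc (2 : ℝ) N ⊆ Set.Ici 2 := Set.Icc_subset_Ici_self
  have hparts := sum_mul_eq_sub_sub_integral_mul
    (fun n : ℕ => if n.Prime ∧ n ∈ S then (1 : ℝ) else 0) (f := fun t : ℝ => Real.log t / t)
    (a := 2) (b := N) (by norm_num) hN' (fun t ht => (hfd t ht.1).differentiableAt)
    ((hf'c.mono hsub).integrableOn_Icc.congr_fun (fun t ht => (hfd t ht.1).deriv.symm)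
      measurableSet_Icc)
  rw [Nat.floor_natCast, Nat.floor_ofNat] at hparts
  have hc2 := sum_primes_eq_primeCount S (t := 2) (by norm_num)
  have hcN := sum_primes_eq_primeCount S (t := N) (by linarith)
  rw [Nat.floor_ofNat] at hc2
  rw [Nat.floor_natCast] at hcN
  rw [hparts, hc2, hcN]
  have hLiInt : IntervalIntegrable (fun t => f' t * Li t) MeasureTheory.volume 2 N := by
    refine ContinuousOn.intervalIntegrable ?_
    rw [Set.uIcc_of_le hN']
    exact (hf'c.mul hLic).mono hsub
  have hEInt : IntervalIntegrable (fun t => f' t * E t) MeasureTheory.volume 2 N :=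
    (intervalIntegrable_iff_integrableOn_Ioc_of_le hN').2 (hint.mono_set Set.Ioc_subset_Ioi_self)
  have hLiEq : ∫ t in (2 : ℝ)..N, f' t * Li t =
      (Real.log N / N * Li N - Real.log N) - (Real.log 2 / 2 * Li 2 - Real.log 2) := by
    refine intervalIntegral.integral_eq_sub_of_hasDerivAt
      (f := fun t => Real.log t / t * Li t - Real.log t) (fun t ht => ?_) hLiInt
    rw [Set.uIcc_of_le hN'] at ht
    have ht2 : 2 ≤ t := ht.1
    have hl : Real.log t ≠ 0 := (Real.log_pos (by linarith)).ne'
    have ht0 : t ≠ 0 := by linarith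
    refine (((hfd t ht2).mul (hasDerivAt_Li ht2)).sub (Real.hasDerivAt_log ht0)).congr_deriv ?_
    field_simp
    ring
  have hLi2 : Li 2 = 0 := intervalIntegral.integral_same
  have hsplit : ∫ t in Set.Ioc (2 : ℝ) N, deriv (fun t : ℝ => Real.log t / t) t *
        ∑ k ∈ Finset.Icc 0 ⌊t⌋₊, (if k.Prime ∧ k ∈ S then (1 : ℝ) else 0) =
      (∫ t in (2 : ℝ)..N, f' t * E t) + δ * ∫ t in (2 : ℝ)..N, f' t * Li t := by
    rw [← intervalIntegral.integral_const_mul,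
      ← intervalIntegral.integral_add hEInt (hLiInt.const_mul δ),
      intervalIntegral.integral_of_le hN']
    refine MeasureTheory.setIntegral_congr_fun measurableSet_Ioc fun t ht => ?_
    have ht2 : 2 ≤ t := ht.1.le
    rw [(hfd t ht2).deriv, sum_primes_eq_primeCount S (by linarith)]
    simp only [hE]
    ring
  rw [hsplit, hLiEq, hLi2]
  simp only [hE]
  ring

lemma prime_mem_semigroup_iff {S Q : Set ℕ} (hQpp : ∀ q ∈ Q, IsPrimePow q)
    (hQdist : ∀ q₁ ∈ Q, ∀ q₂ ∈ Q, ∀ p : ℕ, p.Prime → p ∣ q₁ → p ∣ q₂ → q₁ = q₂)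
    (hgen : ∀ n : ℕ, n ∈ S ↔ ∃ f : ℕ →₀ ℕ,
      (∀ q ∈ f.support, q ∈ Q) ∧ n = f.prod fun q e => q ^ e)
    {p : ℕ} (hp : p.Prime) : p ∈ S ↔ p ∈ Q := by
  have h := prime_pow_mem_semigroup_iff (e := 1) hQpp hQdist hgen hp
  rw [pow_one] at h
  rw [h]
  constructor
  · rintro (h | ⟨q, hq, -, j, hj⟩)
    · exact absurd h one_ne_zero
    · have h1 : j = 1 := Nat.Prime.eq_one_of_pow (hj ▸ hp)
      rw [h1, pow_one] at hj
      exact hj ▸ hq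
  · exact fun hq => Or.inr ⟨p, hq, dvd_rfl, 1, (pow_one p).symm⟩

/-- Over a set containing at most one power of each prime, the proper prime powers contribute a
convergent sum. -/
lemma summable_log_div_of_not_prime {Q : Set ℕ} (hQpp : ∀ q ∈ Q, IsPrimePow q)
    (hQdist : ∀ q₁ ∈ Q, ∀ q₂ ∈ Q, ∀ p : ℕ, p.Prime → p ∣ q₁ → p ∣ q₂ → q₁ = q₂) :
    Summable fun n : ℕ => if n ∈ Q ∧ ¬ n.Prime then Real.log n / ((n : ℝ) - 1) else 0 := by
  have hinj : Function.Injective fun q : {n : ℕ | n ∈ Q ∧ ¬ n.Prime} => (q : ℕ).minFac := by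
    rintro ⟨q, hq⟩ ⟨r, hr⟩ h
    have h : q.minFac = r.minFac := h
    exact Subtype.ext (hQdist q hq.1 r hr.1 _ (Nat.minFac_prime (hQpp q hq.1).ne_one)
      (Nat.minFac_dvd q) (h ▸ Nat.minFac_dvd r))
  have hs : Summable fun q : {n : ℕ | n ∈ Q ∧ ¬ n.Prime} =>
      8 * ((q : ℕ).minFac : ℝ) ^ (-(3 / 2) : ℝ) :=
    ((Real.summable_nat_rpow.2 (by norm_num)).comp_injective hinj).mul_left 8
  have hs' : Summable ((fun n : ℕ => Real.log n / ((n : ℝ) - 1)) ∘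
      ((↑) : {n : ℕ | n ∈ Q ∧ ¬ n.Prime} → ℕ)) := by
    refine hs.of_nonneg_of_le ?_ ?_
    · rintro ⟨q, hq⟩
      have : (1 : ℝ) < q := by exact_mod_cast (hQpp q hq.1).one_lt
      exact div_nonneg (Real.log_natCast_nonneg q) (by linarith)
    · rintro ⟨q, hq⟩
      have h2 : (2 : ℝ) ≤ q := by exact_mod_cast (hQpp q hq.1).two_le
      have hmin : ((q.minFac : ℝ)) ^ 2 ≤ q := by
        exact_mod_cast Nat.minFac_sq_le_self (hQpp q hq.1).pos hq.2
      have hmp : (0 : ℝ) < q.minFac := by exact_mod_cast Nat.minFac_pos q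
      have hq0 : (0 : ℝ) < q := by linarith
      calc Real.log q / ((q : ℝ) - 1) ≤ ((q : ℝ) ^ (1 / 4 : ℝ) / (1 / 4)) / ((q : ℝ) / 2) := by
            gcongr
            · exact Real.log_le_rpow_div hq0.le (by norm_num)
            · linarith
        _ = 8 * (q : ℝ) ^ (-(3 / 4) : ℝ) := by
            have : (q : ℝ) ^ (-(3 / 4) : ℝ) = (q : ℝ) ^ (1 / 4 : ℝ) / q := by
              rw [eq_div_iff hq0.ne', ← Real.rpow_add_one hq0.ne']
              norm_num
            rw [this]
            field_simp
            norm_num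
        _ ≤ 8 * ((q.minFac : ℝ) ^ 2) ^ (-(3 / 4) : ℝ) := by
            gcongr 8 * ?_
            exact Real.rpow_le_rpow_of_nonpos (by positivity) hmin (by norm_num)
        _ = 8 * (q.minFac : ℝ) ^ (-(3 / 2) : ℝ) := by
            rw [← Real.rpow_natCast, ← Real.rpow_mul hmp.le]
            norm_num
  rw [summable_subtype_iff_indicator] at hs'
  refine hs'.congr fun n => ?_
  simp [Set.indicator_apply]

lemma tendsto_log_sub_log_floor :
    Tendsto (fun x : ℝ => Real.log x - Real.log ⌊x⌋₊) atTop (nhds 0) := by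
  have h := ((Real.continuousAt_log one_ne_zero).tendsto.comp
    (tendsto_nat_floor_div_atTop (R := ℝ))).neg
  rw [Real.log_one, neg_zero] at h
  refine h.congr' ?_
  filter_upwards [eventually_ge_atTop 1] with x hx
  have h1 : (⌊x⌋₊ : ℝ) ≠ 0 := by exact_mod_cast (Nat.floor_pos.2 hx).ne'
  simp only [Function.comp]
  rw [Real.log_div h1 (by linarith)]
  ring

lemma sum_range_succ_inv_eq_harmonic (N : ℕ) :
    ∑ n ∈ Finset.range (N + 1), (n : ℝ)⁻¹ = (harmonic N : ℝ) := by
  rw [Finset.sum_range_succ', harmonic]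
  push_cast
  simp

/-- The sums `∑ log q / (q - 1)` over the generators, compared with `δ` times the harmonic sums,
converge under Condition B. -/
lemma exists_tendsto_sum_generators {S Q : Set ℕ} {δ ρ : ℝ} (hρ : 0 < ρ)
    (hB : ConditionB S δ ρ) (hQpp : ∀ q ∈ Q, IsPrimePow q)
    (hQdist : ∀ q₁ ∈ Q, ∀ q₂ ∈ Q, ∀ p : ℕ, p.Prime → p ∣ q₁ → p ∣ q₂ → q₁ = q₂)
    (hgen : ∀ n : ℕ, n ∈ S ↔ ∃ f : ℕ →₀ ℕ,
      (∀ q ∈ f.support, q ∈ Q) ∧ n = f.prod fun q e => q ^ e) :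
    ∃ ℓ : ℝ, Tendsto (fun N : ℕ => ∑ n ∈ Finset.range N,
      ((if n ∈ Q then Real.log n / ((n : ℝ) - 1) else 0) - δ * (n : ℝ)⁻¹)) atTop (nhds ℓ) := by
  obtain ⟨ℓ, hℓ⟩ := exists_tendsto_sum_log_div_sub hρ hB
  set a : ℕ → ℝ := fun n => if n ∈ Q then Real.log n / ((n : ℝ) - 1) else 0 with ha
  set m : ℕ → ℝ := fun n => Real.log n / n * (if n.Prime ∧ n ∈ S then 1 else 0) with hm
  have hprime := fun {p : ℕ} (hp : p.Prime) => prime_mem_semigroup_iff hQpp hQdist hgen hp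
  have hr : Summable fun n => a n - m n := by
    refine Summable.of_norm_bounded (((summable_log_mul_rpow_neg one_lt_two).mul_left 2).add
      (summable_log_div_of_not_prime hQpp hQdist)) fun n => ?_
    have hlog := Real.log_natCast_nonneg n
    have hpow : 0 ≤ 2 * (Real.log n * (n : ℝ) ^ (-2 : ℝ)) := by positivity
    by_cases hnQ : n ∈ Q
    · have h2 : (2 : ℝ) ≤ n := by exact_mod_cast (hQpp n hnQ).two_le
      by_cases hp : n.Prime
      · have hnS := (hprime hp).2 hnQ
        simp only [ha, hm, hnQ, hp, hnS, and_self, not_true_eq_false, and_false, if_true, if_false,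
          mul_one, add_zero]
        have h1 : (n : ℝ) - 1 ≠ 0 := by linarith
        have h0 : (n : ℝ) ≠ 0 := by linarith
        have heq : Real.log n / ((n : ℝ) - 1) - Real.log n / n =
            Real.log n * (1 / (((n : ℝ) - 1) * n)) := by
          field_simp
          ring
        have hpos : 0 < ((n : ℝ) - 1) * n := mul_pos (by linarith) (by linarith)
        rw [heq, Real.norm_of_nonneg (by positivity), mul_left_comm]
        refine mul_le_mul_of_nonneg_left ?_ hlog
        rw [Real.rpow_neg (by positivity), Real.rpow_two, ← div_eq_mul_inv,
          div_le_div_iff₀ hpos (by positivity)]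
        nlinarith
      · simp only [ha, hm, hnQ, hp, false_and, not_false_eq_true, and_self, if_true, if_false,
          mul_zero, sub_zero]
        rw [Real.norm_of_nonneg (div_nonneg hlog (by linarith))]
        linarith
    · have h0 : ¬ (n.Prime ∧ n ∈ S) := fun h => hnQ ((hprime h.1).1 h.2)
      simpa [ha, hm, hnQ, h0] using hpow
  have hR := (tendsto_add_atTop_iff_nat 1).2 hr.hasSum.tendsto_sum_nat
  have hH := Real.tendsto_harmonic_sub_log.const_mul δ
  refine ⟨_, (tendsto_add_atTop_iff_nat 1).1 (Tendsto.congr' ?_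
    (((hℓ.add hR).sub hH).add_const (∑ n ∈ Finset.range 3, m n)))⟩
  filter_upwards [eventually_ge_atTop 2] with N hN
  have hsplit : ∑ n ∈ Finset.range (N + 1), m n =
      ∑ n ∈ Finset.range 3, m n + ∑ n ∈ Finset.Ioc 2 N, m n := by
    have : Finset.Ioc 2 N = Finset.Ico 3 (N + 1) := by
      ext n
      simp only [Finset.mem_Ioc, Finset.mem_Ico]
      omega
    rw [this, Finset.sum_range_add_sum_Ico _ (by omega)]
  rw [Finset.sum_sub_distrib, Finset.sum_sub_distrib, ← Finset.mul_sum,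
    sum_range_succ_inv_eq_harmonic, hsplit]
  ring

/-- Comparison of `log n / (n ^ s - 1)` with `log n / (n - 1) * n ^ (1 - s)`. -/
lemma abs_log_div_rpow_sub_one_sub_le {n : ℕ} (hn : 2 ≤ n) {s : ℝ} (hs : 1 < s) :
    |Real.log n / ((n : ℝ) ^ s - 1) - Real.log n / ((n : ℝ) - 1) * (n : ℝ) ^ (-(s - 1))| ≤
      4 * (Real.log n * (n : ℝ) ^ (-2 : ℝ)) := by
  have h2 : (2 : ℝ) ≤ n := by exact_mod_cast hn
  have h0 : (0 : ℝ) < n := by linarith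
  have hx : 1 ≤ (n : ℝ) ^ (s - 1) := Real.one_le_rpow (by linarith) (by linarith)
  have hns : (n : ℝ) ^ s = n * (n : ℝ) ^ (s - 1) := by
    rw [Real.rpow_sub_one h0.ne']
    field_simp
  rw [hns, Real.rpow_neg h0.le, Real.rpow_neg h0.le, Real.rpow_two]
  generalize (n : ℝ) ^ (s - 1) = x at *
  have hn1 : 0 < (n : ℝ) - 1 := by linarith
  have hnx : (n : ℝ) - 1 ≤ n * x - 1 := by nlinarith
  have hnx0 : 0 < n * x - 1 := by linarith
  have hx0 : 0 < x := by linarith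
  have hlog := Real.log_natCast_nonneg n
  have heq : Real.log n / (n * x - 1) - Real.log n / ((n : ℝ) - 1) * x⁻¹ =
      -(Real.log n * ((x - 1) / x / (((n : ℝ) - 1) * (n * x - 1)))) := by
    field_simp
    ring
  have hfrac : 0 ≤ (x - 1) / x := div_nonneg (by linarith) hx0.le
  have hfrac1 : (x - 1) / x ≤ 1 := (div_le_one hx0).2 (by linarith)
  rw [heq, abs_neg, abs_of_nonneg (by positivity), mul_left_comm]
  refine mul_le_mul_of_nonneg_left ?_ hlog
  calc (x - 1) / x / (((n : ℝ) - 1) * (n * x - 1)) ≤ 1 / (((n : ℝ) / 2) * ((n : ℝ) / 2)) := by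
        gcongr <;> linarith
    _ = _ := by
        field_simp
        norm_num

/-- If the multiplicative set `S` satisfies Condition B with density `δ` and exponent
`ρ`, and moreover `S` is the free multiplicative semigroup generated by a set `Q` of
prime powers with at most one power of each prime (i.e. `S` consists exactly of `1`
and all finite products of elements of `Q`, each element of `S` having a unique such
representation), then
`γ_S = lim_{x → ∞} (δ log x - ∑_{q ∈ Q, q ≤ x} log q / (q - 1))`. -/
theorem eulerKronecker_of_semigroup (S : Set ℕ) (Q : Set ℕ) (δ ρ γS : ℝ)
    (hδ : 0 < δ) (hρ : 0 < ρ) (hS : IsMultiplicativeSet S) (hB : ConditionB S δ ρ)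
    (hEK : IsEulerKronecker S δ γS)
    (hQpp : ∀ q ∈ Q, IsPrimePow q)
    (hQdist : ∀ q₁ ∈ Q, ∀ q₂ ∈ Q, ∀ p : ℕ, p.Prime → p ∣ q₁ → p ∣ q₂ → q₁ = q₂)
    (hgen : ∀ n : ℕ, n ∈ S ↔ ∃ f : ℕ →₀ ℕ,
      (∀ q ∈ f.support, q ∈ Q) ∧ n = f.prod fun q e => q ^ e)
    (hfree : ∀ f g : ℕ →₀ ℕ, (∀ q ∈ f.support, q ∈ Q) → (∀ q ∈ g.support, q ∈ Q) →
      (f.prod fun q e => q ^ e) = (g.prod fun q e => q ^ e) → f = g) :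
    Tendsto (fun x : ℝ =>
        δ * Real.log x -
          ∑ q ∈ (Finset.Icc 1 ⌊x⌋₊).filter (· ∈ Q), Real.log q / ((q : ℝ) - 1))
      atTop (nhds γS) := by
  obtain ⟨ℓ, hℓ⟩ := exists_tendsto_sum_generators hρ hB hQpp hQdist hgen
  set a : ℕ → ℝ := fun n => if n ∈ Q then Real.log n / ((n : ℝ) - 1) else 0 with ha
  set u : ℝ → ℕ → ℝ := fun s n => if n ∈ Q then Real.log n / ((n : ℝ) ^ s - 1) else 0 with hu
  have hQ2 : ∀ q ∈ Q, 2 ≤ q := fun q hq => (hQpp q hq).two_le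
  have ha0 : a 0 = 0 := by simp [ha]
  have hsa : ∀ ε : ℝ, 0 < ε → Summable fun n : ℕ => a n * (n : ℝ) ^ (-ε) := by
    intro ε hε
    refine Summable.of_norm_bounded
      ((summable_log_mul_rpow_neg (show 1 < 1 + ε by linarith)).mul_left 2) fun n => ?_
    have hlog := Real.log_natCast_nonneg n
    by_cases hn : n ∈ Q
    · have h2 : (2 : ℝ) ≤ n := by exact_mod_cast hQ2 n hn
      have h0 : (0 : ℝ) < n := by linarith
      have h1 : (0 : ℝ) < n - 1 := by linarith
      simp only [ha, hn, if_true]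
      rw [Real.norm_of_nonneg (by positivity), neg_add, Real.rpow_add h0, Real.rpow_neg_one,
        ← mul_assoc, ← mul_assoc]
      refine mul_le_mul_of_nonneg_right ?_ (by positivity)
      rw [← div_eq_mul_inv, div_le_div_iff₀ h1 h0]
      nlinarith
    · simp only [ha, hn, if_false, zero_mul, norm_zero]
      positivity
  have hzeta : ∀ (ε : ℝ) (n : ℕ), 0 < ε →
      δ * (n : ℝ)⁻¹ * (n : ℝ) ^ (-ε) = δ * (n : ℝ) ^ (-(1 + ε)) := by
    intro ε n hε
    rcases Nat.eq_zero_or_pos n with rfl | hn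
    · rw [Nat.cast_zero, Real.zero_rpow (show -(1 + ε) ≠ 0 by linarith), inv_zero]
      ring
    · have h0 : (0 : ℝ) < n := by exact_mod_cast hn
      rw [neg_add, Real.rpow_add h0, Real.rpow_neg_one, mul_assoc]
  have hsz : ∀ ε : ℝ, 0 < ε → Summable fun n : ℕ => δ * (n : ℝ)⁻¹ * (n : ℝ) ^ (-ε) := by
    intro ε hε
    simp_rw [fun n => hzeta ε n hε]
    exact (Real.summable_nat_rpow.2 (by linarith)).mul_left δ
  have habel := tendsto_tsum_mul_rpow_neg (by simp) hℓ fun ε hε => by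
    simpa only [sub_mul] using (hsa ε hε).sub (hsz ε hε)
  have hshift : Tendsto (fun s : ℝ => s - 1) (nhdsWithin 1 (Set.Ioi 1))
      (nhdsWithin 0 (Set.Ioi 0)) := by
    refine tendsto_nhdsWithin_iff.2 ⟨?_, ?_⟩
    · have : Tendsto (fun s : ℝ => s - 1) (nhds 1) (nhds (1 - 1)) := tendsto_id.sub_const 1
      rw [sub_self] at this
      exact this.mono_left nhdsWithin_le_nhds
    · filter_upwards [self_mem_nhdsWithin] with s hs
      exact sub_pos.2 (Set.mem_Ioi.1 hs)
  have hbound : ∀ s : ℝ, 1 < s → ∀ n : ℕ,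
      ‖u s n - a n * (n : ℝ) ^ (-(s - 1))‖ ≤ 4 * (Real.log n * (n : ℝ) ^ (-2 : ℝ)) := by
    intro s hs n
    by_cases hn : n ∈ Q
    · simpa [hu, ha, hn] using abs_log_div_rpow_sub_one_sub_le (hQ2 n hn) hs
    · simp only [hu, ha, hn, if_false, zero_mul, sub_zero, norm_zero]
      have hlog := Real.log_natCast_nonneg n
      positivity
  have hsb : Summable fun n : ℕ => 4 * (Real.log n * (n : ℝ) ^ (-2 : ℝ)) :=
    (summable_log_mul_rpow_neg one_lt_two).mul_left 4
  have hdiff : Tendsto (fun s : ℝ => ∑' n : ℕ, (u s n - a n * (n : ℝ) ^ (-(s - 1))))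
      (nhdsWithin 1 (Set.Ioi 1)) (nhds 0) := by
    rw [← tsum_zero (α := ℝ) (β := ℕ)]
    refine tendsto_tsum_of_dominated_convergence hsb (fun n => ?_) ?_
    · by_cases hn : n ∈ Q
      · have h2 : (2 : ℝ) ≤ n := by exact_mod_cast hQ2 n hn
        have h0 : (n : ℝ) ≠ 0 := by linarith
        have h1 : (n : ℝ) ^ (1 : ℝ) - 1 ≠ 0 := by rw [Real.rpow_one]; linarith
        simp only [hu, ha, hn, if_true]
        have hc : ContinuousAt (fun s : ℝ => Real.log n / ((n : ℝ) ^ s - 1) -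
            Real.log n / ((n : ℝ) - 1) * (n : ℝ) ^ (-(s - 1))) 1 := by
          have hcs : ContinuousAt (fun s : ℝ => (n : ℝ) ^ s) 1 :=
            Real.continuousAt_const_rpow h0
          have hct : ContinuousAt (fun s : ℝ => (n : ℝ) ^ (-(s - 1))) 1 :=
            (Real.continuousAt_const_rpow h0).comp (by fun_prop)
          exact (continuousAt_const.div (hcs.sub continuousAt_const) h1).sub
            (continuousAt_const.mul hct)
        have h := hc.tendsto
        simp only [Real.rpow_one, sub_self, neg_zero, Real.rpow_zero, mul_one] at h
        exact h.mono_left nhdsWithin_le_nhds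
      · simp [hu, ha, hn]
    · filter_upwards [self_mem_nhdsWithin] with s hs
      exact hbound s hs
  have hdiff' := hdiff.neg
  rw [neg_zero] at hdiff'
  have hγ : γS = 0 - ℓ - δ * Real.eulerMascheroniConstant := by
    refine tendsto_nhds_unique hEK (Tendsto.congr' ?_ ((hdiff'.sub (habel.comp hshift)).sub
      (tendsto_tsum_rpow_neg_sub_one_div.const_mul δ)))
    filter_upwards [self_mem_nhdsWithin] with s hs
    have hs : 1 < s := hs
    have hs0 : 0 < s - 1 := by linarith
    have hsd : Summable fun n : ℕ => u s n - a n * (n : ℝ) ^ (-(s - 1)) :=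
      Summable.of_norm_bounded hsb (hbound s hs)
    have hu_tsum : ∑' q : Q, Real.log (q : ℕ) / (((q : ℕ) : ℝ) ^ s - 1) = ∑' n, u s n := by
      rw [tsum_subtype Q fun n : ℕ => Real.log n / ((n : ℝ) ^ s - 1)]
      simp only [hu, Set.indicator_apply]
    have hu_split : ∑' n, u s n = ∑' n : ℕ, (u s n - a n * (n : ℝ) ^ (-(s - 1))) +
        ∑' n : ℕ, a n * (n : ℝ) ^ (-(s - 1)) := by
      rw [← hsd.tsum_add (hsa _ hs0)]
      simp
    have hc_split : ∑' n : ℕ, (a n - δ * (n : ℝ)⁻¹) * (n : ℝ) ^ (-(s - 1)) =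
        ∑' n : ℕ, a n * (n : ℝ) ^ (-(s - 1)) - δ * ∑' n : ℕ, (n : ℝ) ^ (-s) := by
      simp only [sub_mul (_ : ℝ) (_ * _)]
      rw [(hsa _ hs0).tsum_sub (hsz _ hs0), ← tsum_mul_left]
      simp only [fun n => hzeta (s - 1) n hs0, add_sub_cancel]
    rw [deriv_div_self_of_hasProd (fun q hq => (hQpp q hq).one_lt)
      (fun y hy => hasProd_LSeries' hS hQpp hQdist hgen hy) hs, hu_tsum, hu_split]
    simp only [Function.comp]
    rw [hc_split]
    ring
  rw [hγ]
  have hfl := tendsto_nat_floor_atTop (α := ℝ)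
  have hmain := (((tendsto_log_sub_log_floor.const_mul δ).sub
    (((tendsto_add_atTop_iff_nat 1).2 hℓ).comp hfl)).sub
    ((Real.tendsto_harmonic_sub_log.comp hfl).const_mul δ))
  rw [mul_zero] at hmain
  refine hmain.congr fun x => ?_
  have hsum : ∑ q ∈ (Finset.Icc 1 ⌊x⌋₊).filter (· ∈ Q), Real.log q / ((q : ℝ) - 1) =
      ∑ n ∈ Finset.range (⌊x⌋₊ + 1), a n := by
    rw [Finset.sum_filter, Finset.range_eq_Ico, Finset.sum_eq_sum_Ico_succ_bot (by omega), ha0,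
      zero_add]
    rfl
  simp only [Function.comp]
  rw [hsum, Finset.sum_sub_distrib, ← Finset.mul_sum, sum_range_succ_inv_eq_harmonic]
  ring
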